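/- If λ ≥ λ_T, then the optimal SVM loss satisfies 1 − (r_max/λ)·H(f̃) ≤ L*_SVM(f;λ) ≤ 1 − (r_min/λ)·H(f̃), where r_max, r_min are the maximum and minimum positive eigenvalues of Λ_{f̃} = E[f̃(X)f̃(X)ᵀ] and H(f̃) is the H-score of the centered feature. In particular if Λ_{f̃} = I then L*_SVM(f;λ) = 1 − H(f̃)/λ. -/

import Mathlib

open Matrix

/-- The identity `v ⬝ᵥ Λ v = μ ⬝ᵥ μ` for `v = S μ`, when `S` is a symmetric square root
of `Λ⁻¹`. -/
lemma dotProduct_mulVec_of_mul_self_eq_inv {n : Type*} [Fintype n] [DecidableEq n]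
    {Λ S : Matrix n n ℝ} (hΛ : IsUnit Λ.det) (hS : S.IsHermitian) (hSS : S * S = Λ⁻¹)
    (μ : n → ℝ) : (S *ᵥ μ) ⬝ᵥ (Λ *ᵥ (S *ᵥ μ)) = μ ⬝ᵥ μ := by
  have h : S * Λ * S = 1 := by
    rw [mul_eq_one_comm, ← Matrix.mul_assoc, hSS, Matrix.nonsing_inv_mul _ hΛ]
  have hT : Sᵀ = S := by simpa [Matrix.IsHermitian] using hS
  rw [dotProduct_comm, dotProduct_mulVec, ← mulVec_transpose, hT, mulVec_mulVec, mulVec_mulVec,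
    h, one_mulVec]

/-- Cauchy–Schwarz for the dot product. -/
lemma abs_dotProduct_le_sqrt_mul_sqrt {n : Type*} [Fintype n] (v w : n → ℝ) :
    |v ⬝ᵥ w| ≤ √(v ⬝ᵥ v) * √(w ⬝ᵥ w) := by
  have hv : 0 ≤ v ⬝ᵥ v := Finset.sum_nonneg fun i _ => mul_self_nonneg (v i)
  rw [← Real.sqrt_mul hv]
  apply Real.abs_le_sqrt
  simpa [dotProduct, sq] using Finset.sum_mul_sq_le_sq_mul_sq Finset.univ v w

/-- For balanced labels and strong enough regularization, the regularized hinge loss has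
minimum `1 - ‖E[f Y]‖² / (2λ)`. -/
lemma isLeast_svm_loss {Ω n : Type*} [Fintype Ω] [Fintype n] {p Y : Ω → ℝ}
    (hp : ∀ ω, 0 ≤ p ω) (hp1 : ∑ ω, p ω = 1) (hY : ∀ ω, |Y ω| ≤ 1)
    (hpY : ∑ ω, p ω * Y ω = 0) (f : Ω → n → ℝ) (m : n → ℝ) {M lam : ℝ}
    (hM : ∀ ω, 0 < p ω → √((f ω - m) ⬝ᵥ (f ω - m)) ≤ M) (hlam : 0 < lam)
    {μ : n → ℝ} (hμ : μ = ∑ ω, (p ω * Y ω) • f ω) (hlamT : M * √(μ ⬝ᵥ μ) ≤ lam) :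
    IsLeast {r : ℝ | ∃ (w : n → ℝ) (b : ℝ), r =
        (∑ ω, p ω * max (1 - Y ω * (w ⬝ᵥ f ω + b)) 0) + lam / 2 * (w ⬝ᵥ w)}
      (1 - (μ ⬝ᵥ μ) / (2 * lam)) := by
  have key (w : n → ℝ) (b : ℝ) :
      ∑ ω, p ω * (1 - Y ω * (w ⬝ᵥ f ω + b)) = 1 - w ⬝ᵥ μ := by
    have h1 : w ⬝ᵥ μ = ∑ ω, p ω * Y ω * (w ⬝ᵥ f ω) := by
      simp [hμ, dotProduct_sum, dotProduct_smul]
    have h2 (ω : Ω) : p ω * (1 - Y ω * (w ⬝ᵥ f ω + b)) =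
        p ω - p ω * Y ω * (w ⬝ᵥ f ω) - p ω * Y ω * b := by ring
    simp_rw [h2]
    rw [Finset.sum_sub_distrib, Finset.sum_sub_distrib, ← Finset.sum_mul, hp1, hpY, h1]
    ring
  constructor
  · refine ⟨lam⁻¹ • μ, -((lam⁻¹ • μ) ⬝ᵥ m), ?_⟩
    have hmax (ω : Ω) :
        p ω * max (1 - Y ω * ((lam⁻¹ • μ) ⬝ᵥ f ω + -((lam⁻¹ • μ) ⬝ᵥ m))) 0 =
        p ω * (1 - Y ω * ((lam⁻¹ • μ) ⬝ᵥ f ω + -((lam⁻¹ • μ) ⬝ᵥ m))) := by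
      rcases (hp ω).eq_or_lt with h0 | h0
      · simp [← h0]
      rw [max_eq_left]
      rw [← sub_eq_add_neg, ← dotProduct_sub, smul_dotProduct, smul_eq_mul, sub_nonneg]
      refine (le_abs_self _).trans ?_
      rw [abs_mul, abs_mul, abs_of_pos (inv_pos.2 hlam)]
      refine mul_le_one₀ (hY ω) (by positivity) ?_
      rw [inv_mul_le_one₀ hlam]
      calc |μ ⬝ᵥ (f ω - m)| ≤ √(μ ⬝ᵥ μ) * √((f ω - m) ⬝ᵥ (f ω - m)) :=
            abs_dotProduct_le_sqrt_mul_sqrt _ _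
        _ ≤ √(μ ⬝ᵥ μ) * M := by gcongr; exact hM ω h0
        _ ≤ lam := by rwa [mul_comm]
    simp_rw [hmax]
    rw [key]
    simp only [smul_dotProduct, dotProduct_smul, smul_eq_mul]
    field_simp
    ring
  · rintro r ⟨w, b, rfl⟩
    have h1 : 1 - w ⬝ᵥ μ ≤ ∑ ω, p ω * max (1 - Y ω * (w ⬝ᵥ f ω + b)) 0 := by
      rw [← key w b]
      gcongr with ω
      · exact hp ω
      · exact le_max_left _ _
    have h2 : 0 ≤ (lam • w - μ) ⬝ᵥ (lam • w - μ) :=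
      Finset.sum_nonneg fun i _ => mul_self_nonneg _
    simp only [sub_dotProduct, dotProduct_sub, smul_dotProduct, dotProduct_smul,
      smul_eq_mul, dotProduct_comm μ w] at h2
    have h3 : w ⬝ᵥ μ - lam / 2 * (w ⬝ᵥ w) ≤ (μ ⬝ᵥ μ) / (2 * lam) := by
      rw [le_div_iff₀ (by positivity)]
      nlinarith
    linarith

/-- If `λ ≥ λ_T = M ‖E[f(X)Y]‖`, the optimal SVM loss satisfies
`1 - (r_max/λ) H(f̃) ≤ L*_SVM(f;λ) ≤ 1 - (r_min/λ) H(f̃)`, where `r_max, r_min`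
are the maximum and minimum (positive) eigenvalues of `Λ_{f̃} = E[f̃ f̃ᵀ]` and
`H(f̃) = (1/2) E[‖Λ_{f̃}^{-1/2} E[f̃(X)|Y]‖²]` is the H-score of the centered
feature (`S` denotes `Λ_{f̃}^{-1/2}`, any symmetric matrix with `S S = Λ⁻¹`).
In particular if `Λ_{f̃} = I` then `L*_SVM(f;λ) = 1 - H(f̃)/λ`. -/
theorem stmt13 {Ω : Type*} [Fintype Ω] (p : Ω → ℝ)
    (hp : ∀ ω, 0 ≤ p ω) (hp1 : ∑ ω, p ω = 1)
    {d : ℕ} (f : Ω → Fin d → ℝ) (Y : Ω → ℝ)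
    (hY : ∀ ω, Y ω = 1 ∨ Y ω = -1)
    (hunif : ∑ ω, (if Y ω = 1 then p ω else 0) = 1 / 2)
    (mf : Fin d → ℝ) (hmf : mf = ∑ ω, p ω • f ω)
    (ft : Ω → Fin d → ℝ) (hft : ∀ ω, ft ω = f ω - mf)
    (μ : Fin d → ℝ) (hμ : μ = ∑ ω, (p ω * Y ω) • f ω)
    (Λ : Matrix (Fin d) (Fin d) ℝ)
    (hΛ : ∀ i j, Λ i j = ∑ ω, p ω * ft ω i * ft ω j)
    (hPD : Λ.PosDef)
    (S : Matrix (Fin d) (Fin d) ℝ) (hSh : S.IsHermitian) (hSS : S * S = Λ⁻¹)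
    (E1 Em1 : Fin d → ℝ)
    (hE1 : E1 = (2 : ℝ) • ∑ ω, (if Y ω = 1 then p ω else 0) • ft ω)
    (hEm1 : Em1 = (2 : ℝ) • ∑ ω, (if Y ω = -1 then p ω else 0) • ft ω)
    (H : ℝ)
    (hH : H = (1 / 2) * ((1 / 2) * ((S *ᵥ E1) ⬝ᵥ (S *ᵥ E1))
      + (1 / 2) * ((S *ᵥ Em1) ⬝ᵥ (S *ᵥ Em1))))
    (rmin rmax : ℝ)
    (hrminEv : ∃ v : Fin d → ℝ, v ≠ 0 ∧ Λ *ᵥ v = rmin • v)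
    (hrmaxEv : ∃ v : Fin d → ℝ, v ≠ 0 ∧ Λ *ᵥ v = rmax • v)
    (hsand : ∀ v : Fin d → ℝ,
      rmin * (v ⬝ᵥ v) ≤ v ⬝ᵥ (Λ *ᵥ v) ∧ v ⬝ᵥ (Λ *ᵥ v) ≤ rmax * (v ⬝ᵥ v))
    (M : ℝ) (hM : ∀ ω, 0 < p ω → Real.sqrt (ft ω ⬝ᵥ ft ω) ≤ M)
    (lam : ℝ) (hlam : 0 < lam)
    (hlamT : M * Real.sqrt (μ ⬝ᵥ μ) ≤ lam) :
    (1 - rmax / lam * H ≤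
      sInf {r : ℝ | ∃ (w : Fin d → ℝ) (b : ℝ), r =
        (∑ ω, p ω * max (1 - Y ω * (w ⬝ᵥ f ω + b)) 0) + lam / 2 * (w ⬝ᵥ w)}) ∧
    (sInf {r : ℝ | ∃ (w : Fin d → ℝ) (b : ℝ), r =
        (∑ ω, p ω * max (1 - Y ω * (w ⬝ᵥ f ω + b)) 0) + lam / 2 * (w ⬝ᵥ w)}
      ≤ 1 - rmin / lam * H) ∧
    (Λ = 1 →
      sInf {r : ℝ | ∃ (w : Fin d → ℝ) (b : ℝ), r =
        (∑ ω, p ω * max (1 - Y ω * (w ⬝ᵥ f ω + b)) 0) + lam / 2 * (w ⬝ᵥ w)}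
      = 1 - H / lam) := by
  have hsplit (ω : Ω) : (if Y ω = 1 then p ω else 0) = (p ω + p ω * Y ω) / 2 ∧
      (if Y ω = -1 then p ω else 0) = (p ω - p ω * Y ω) / 2 := by
    rcases hY ω with h | h <;> constructor <;> norm_num [h]
  have hpY : ∑ ω, p ω * Y ω = 0 := by
    simp_rw [fun ω => (hsplit ω).1] at hunif
    rw [← Finset.sum_div, Finset.sum_add_distrib, hp1] at hunif
    linarith
  have hpft : ∑ ω, p ω • ft ω = 0 := by
    simp_rw [hft, smul_sub]
    rw [Finset.sum_sub_distrib, ← Finset.sum_smul, hp1, ← hmf, one_smul, sub_self]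
  have hpYft : ∑ ω, (p ω * Y ω) • ft ω = μ := by
    simp_rw [hft, smul_sub]
    rw [Finset.sum_sub_distrib, ← Finset.sum_smul, hpY, ← hμ, zero_smul, sub_zero]
  have hE1μ : E1 = μ := by
    rw [hE1, Finset.smul_sum, ← add_zero μ, ← hpYft, ← hpft, ← Finset.sum_add_distrib]
    refine Finset.sum_congr rfl fun ω _ => ?_
    rw [(hsplit ω).1]
    module
  have hEm1μ : Em1 = -μ := by
    rw [hEm1, Finset.smul_sum, ← zero_sub μ, ← hpYft, ← hpft, ← Finset.sum_sub_distrib]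
    refine Finset.sum_congr rfl fun ω _ => ?_
    rw [(hsplit ω).2]
    module
  have hHv : (S *ᵥ μ) ⬝ᵥ (S *ᵥ μ) = 2 * H := by
    rw [hH, hE1μ, hEm1μ, mulVec_neg, neg_dotProduct_neg]
    ring
  have hdual := dotProduct_mulVec_of_mul_self_eq_inv hPD.det_pos.ne'.isUnit hSh hSS μ
  have hinf := (isLeast_svm_loss hp hp1
    (fun ω => by rcases hY ω with h | h <;> simp [h]) hpY f mf
    (fun ω h => by simpa only [hft] using hM ω h) hlam hμ hlamT).csInf_eq
  obtain ⟨hlo, hhi⟩ := hsand (S *ᵥ μ)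
  rw [hdual, hHv] at hlo hhi
  rw [hinf]
  refine ⟨?_, ?_, fun hΛ1 => ?_⟩
  · have : (μ ⬝ᵥ μ) / (2 * lam) ≤ rmax / lam * H := by
      rw [div_le_iff₀ (by positivity)]
      field_simp
      linarith
    linarith
  · have : rmin / lam * H ≤ (μ ⬝ᵥ μ) / (2 * lam) := by
      rw [le_div_iff₀ (by positivity)]
      field_simp
      linarith
    linarith
  · rw [hΛ1, one_mulVec, hHv] at hdual
    rw [← hdual, mul_div_mul_left _ _ two_ne_zero]
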